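/- (Asymptotic optimality of compress-and-forward.) Let M, N be positive integers, G a 2×M complex matrix, H = [h₁ h₂] an N×2 complex matrix with h₁ ≠ 0 and h₂ ≠ 0, and P_s > 0. For P > 0 define R_CF(P) as the supremum of log[ det(I₂ + A + G Q G†) / ((1+a)(1+b)) ] over all M×M positive semidefinite Hermitian Q with tr(Q) ≤ P_s and all reals a, b > 0 (with A = diag(a,b)) satisfying the three constraints: det(I₂ + A + GQG†) / (a·(1 + b + (GQG†)₂₂)) ≤ 1 + P‖h₁‖², det(I₂ + A + GQG†) / (b·(1 + a + (GQG†)₁₁)) ≤ 1 + P‖h₂‖², and det(I₂ + A + GQG†) / (a·b) ≤ det(I_N + H·diag(P,P)·H†). Let C* = sup over positive semidefinite Q with tr(Q) ≤ P_s of log det(I_M + G Q G†). Then R_CF(P) → C* as P → ∞; in particular this holds regardless of the rank of H. -/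

import Mathlib

open Matrix Complex Filter

/-- The `N × 2` matrix with columns `h₁` and `h₂`. -/
noncomputable def Hm {N : ℕ} (h₁ h₂ : Fin N → ℂ) : Matrix (Fin N) (Fin 2) ℂ :=
  Matrix.of fun i j => if j = 0 then h₁ i else h₂ i

/-- The Hermitian inner product `h₁† h₂ = ∑ i, conj (h₁ i) * h₂ i`. -/
noncomputable def ip {N : ℕ} (h₁ h₂ : Fin N → ℂ) : ℂ :=
  ∑ i, (starRingEnd ℂ) (h₁ i) * h₂ i

/-- The squared Euclidean norm `‖h‖²`. -/
noncomputable def nsq {N : ℕ} (h : Fin N → ℂ) : ℝ :=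
  ∑ i, Complex.normSq (h i)

/-- `det (H† H)`, a nonnegative real number (taken via the real part). -/
noncomputable def detHH {N : ℕ} (h₁ h₂ : Fin N → ℂ) : ℝ :=
  (((Hm h₁ h₂)ᴴ * Hm h₁ h₂).det).re

/-- The relay covariance matrix `Q_r(ρ)` with diagonal `P₁, P₂` and
off-diagonal `ρ √(P₁ P₂)`. -/
noncomputable def Qr (P₁ P₂ : ℝ) (ρ : ℂ) : Matrix (Fin 2) (Fin 2) ℂ :=
  !![(P₁ : ℂ), ρ * (Real.sqrt (P₁ * P₂) : ℂ);
     (starRingEnd ℂ) ρ * (Real.sqrt (P₁ * P₂) : ℂ), (P₂ : ℂ)]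

/-- `det (I_N + H Q_r(ρ) H†)` (a real number, taken via the real part). -/
noncomputable def MACdet {N : ℕ} (h₁ h₂ : Fin N → ℂ) (P₁ P₂ : ℝ) (ρ : ℂ) : ℝ :=
  ((1 + Hm h₁ h₂ * Qr P₁ P₂ ρ * (Hm h₁ h₂)ᴴ).det).re

open scoped ComplexOrder

/-- `R_CF(P)`: the supremum of the compress-and-forward rate
`log[det(I₂ + A + G Q G†)/((1+a)(1+b))]`, `A = diag(a,b)`, over source covariances `Q`
(positive semidefinite, `tr Q ≤ P_s`) and quantization noise levels `a, b > 0` subject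
to the three CF constraints (relay powers `P` at both relays). Determinants are real and
taken via real parts. -/
noncomputable def rCF {M N : ℕ} (G : Matrix (Fin 2) (Fin M) ℂ)
    (h₁ h₂ : Fin N → ℂ) (Ps P : ℝ) : ℝ :=
  sSup {r : ℝ | ∃ (Q : Matrix (Fin M) (Fin M) ℂ) (a b : ℝ),
    Q.PosSemidef ∧ Q.trace.re ≤ Ps ∧ 0 < a ∧ 0 < b ∧
    ((1 + Matrix.diagonal ![(a : ℂ), (b : ℂ)] + G * Q * Gᴴ).det).re /
        (a * (1 + b + ((G * Q * Gᴴ) 1 1).re)) ≤ 1 + P * nsq h₁ ∧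
    ((1 + Matrix.diagonal ![(a : ℂ), (b : ℂ)] + G * Q * Gᴴ).det).re /
        (b * (1 + a + ((G * Q * Gᴴ) 0 0).re)) ≤ 1 + P * nsq h₂ ∧
    ((1 + Matrix.diagonal ![(a : ℂ), (b : ℂ)] + G * Q * Gᴴ).det).re / (a * b) ≤
      ((1 + Hm h₁ h₂ * Matrix.diagonal ![(P : ℂ), (P : ℂ)] * (Hm h₁ h₂)ᴴ).det).re ∧
    r = Real.log (((1 + Matrix.diagonal ![(a : ℂ), (b : ℂ)] + G * Q * Gᴴ).det).re /
          ((1 + a) * (1 + b)))}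

/-- `C* = sup {log det(I₂ + G Q G†) : Q PSD, tr Q ≤ P_s}`. -/
noncomputable def Cstar {M : ℕ} (G : Matrix (Fin 2) (Fin M) ℂ) (Ps : ℝ) : ℝ :=
  sSup {c : ℝ | ∃ Q : Matrix (Fin M) (Fin M) ℂ,
    Q.PosSemidef ∧ Q.trace.re ≤ Ps ∧ c = Real.log ((1 + G * Q * Gᴴ).det).re}

lemma psd2 (K : Matrix (Fin 2) (Fin 2) ℂ) (hK : K.PosSemidef) :
    ∃ x y z : ℝ, 0 ≤ x ∧ 0 ≤ y ∧ 0 ≤ z ∧ z ≤ x * y ∧ (K 0 0).re = x ∧ (K 1 1).re = y ∧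
      (∀ a b : ℝ, ((1 + Matrix.diagonal ![(a : ℂ), (b : ℂ)] + K).det).re
        = (1 + a + x) * (1 + b + y) - z) ∧
      (∀ p : ℝ, ((1 + (p : ℂ) • K).det).re = (1 + p * x) * (1 + p * y) - p ^ 2 * z) := by
  have h0 := hK.diag_nonneg (i := 0)
  have h1 := hK.diag_nonneg (i := 1)
  have hd := hK.det_nonneg
  have hH := hK.isHermitian.apply 0 1
  rw [Complex.le_def] at h0 h1 hd
  simp only [Matrix.det_fin_two, ← hH, Complex.zero_re, Complex.zero_im, Complex.sub_re,
    Complex.mul_re, Complex.star_def, Complex.conj_re, Complex.conj_im] at h0 h1 hd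
  obtain ⟨h0, h0'⟩ := h0
  obtain ⟨h1, h1'⟩ := h1
  obtain ⟨hd, -⟩ := hd
  refine ⟨(K 0 0).re, (K 1 1).re, (K 1 0).re ^ 2 + (K 1 0).im ^ 2, h0, h1, by positivity,
    ?_, rfl, rfl, ?_, ?_⟩
  · rw [← h0', ← h1'] at hd
    nlinarith
  · intro a b
    simp [Matrix.det_fin_two, ← hH, ← h0', ← h1']
    ring
  · intro p
    simp [Matrix.det_fin_two, ← hH, ← h0', ← h1']
    ring

lemma trace_bd {M : ℕ} (G : Matrix (Fin 2) (Fin M) ℂ) : ∃ c : ℝ, 0 ≤ c ∧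
    ∀ Q : Matrix (Fin M) (Fin M) ℂ, Q.PosSemidef →
      ((G * Q * Gᴴ) 0 0).re + ((G * Q * Gᴴ) 1 1).re ≤ c * Q.trace.re := by
  have fr : ∀ {m n : ℕ} (B : Matrix (Fin m) (Fin n) ℂ),
      ((Bᴴ * B).trace).re = ∑ j, ∑ i, ‖B i j‖ ^ 2 := by
    intro m n B
    simp [Matrix.trace, Matrix.mul_apply, ← Complex.normSq_eq_norm_sq, Complex.normSq_apply]
  refine ⟨∑ j, ∑ i, ‖Gᴴ i j‖ ^ 2, by positivity, ?_⟩
  intro Q hQ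
  obtain ⟨B, rfl⟩ : ∃ B : Matrix (Fin M) (Fin M) ℂ, Q = Bᴴ * B := by
    open scoped MatrixOrder in
    exact CStarAlgebra.nonneg_iff_eq_star_mul_self.mp hQ.nonneg
  have e : G * (Bᴴ * B) * Gᴴ = (B * Gᴴ)ᴴ * (B * Gᴴ) := by
    simp [Matrix.mul_assoc]
  have : ((G * (Bᴴ * B) * Gᴴ) 0 0).re + ((G * (Bᴴ * B) * Gᴴ) 1 1).re
      = ((G * (Bᴴ * B) * Gᴴ).trace).re := by
    simp [Matrix.trace_fin_two]
  rw [this, e, fr, fr, Finset.sum_comm (f := fun j i => ‖B i j‖ ^ 2), Finset.sum_mul_sum]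
  refine Finset.sum_le_sum fun j _ => Finset.sum_le_sum fun i _ => ?_
  have h1 : ‖(B * Gᴴ) i j‖ ≤ ∑ k, ‖B i k‖ * ‖Gᴴ k j‖ := by
    rw [Matrix.mul_apply]
    exact (norm_sum_le _ _).trans (by simp)
  calc ‖(B * Gᴴ) i j‖ ^ 2 ≤ (∑ k, ‖B i k‖ * ‖Gᴴ k j‖) ^ 2 := by gcongr
    _ ≤ (∑ k, ‖B i k‖ ^ 2) * (∑ k, ‖Gᴴ k j‖ ^ 2) := Finset.sum_mul_sq_le_sq_mul_sq _ _ _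
    _ = _ := mul_comm _ _

lemma bdd_Cstar {M : ℕ} (G : Matrix (Fin 2) (Fin M) ℂ) (Ps : ℝ) :
    BddAbove {c : ℝ | ∃ Q : Matrix (Fin M) (Fin M) ℂ,
    Q.PosSemidef ∧ Q.trace.re ≤ Ps ∧ c = Real.log ((1 + G * Q * Gᴴ).det).re} := by
  obtain ⟨c, hc, hb⟩ := trace_bd G
  refine ⟨Real.log ((1 + c * Ps) * (1 + c * Ps)), ?_⟩
  rintro _ ⟨Q, hQ, ht, rfl⟩
  obtain ⟨x, y, z, hx, hy, hz, hzxy, ex, ey, hD, hp⟩ :=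
    psd2 _ (hQ.mul_mul_conjTranspose_same G)
  have h1 := hp 1
  simp only [Complex.ofReal_one, one_smul, one_mul, one_pow] at h1
  have h2 := hb Q hQ
  rw [ex, ey] at h2
  have h3 := mul_le_mul_of_nonneg_left ht hc
  rw [h1]
  apply Real.log_le_log
  · nlinarith
  · have : (1 + x) * (1 + y) ≤ (1 + c * Ps) * (1 + c * Ps) := by
      apply mul_le_mul <;> linarith
    linarith

lemma nsq_pos {N : ℕ} (h : Fin N → ℂ) (hh : h ≠ 0) : 0 < nsq h := by
  obtain ⟨i, hi⟩ := Function.ne_iff.mp hh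
  exact Finset.sum_pos' (fun i _ => Complex.normSq_nonneg _)
    ⟨i, Finset.mem_univ _, Complex.normSq_pos.mpr hi⟩

lemma det_ge {N : ℕ} (h₁ h₂ : Fin N → ℂ) (P : ℝ) (hP : 0 ≤ P) :
    1 + P * nsq h₁ ≤
      ((1 + Hm h₁ h₂ * Matrix.diagonal ![(P : ℂ), (P : ℂ)] * (Hm h₁ h₂)ᴴ).det).re := by
  obtain ⟨x, y, z, hx, hy, hz, hzxy, ex, ey, hD, hp⟩ :=
    psd2 _ (Matrix.posSemidef_conjTranspose_mul_self (Hm h₁ h₂))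
  have e : (Matrix.diagonal ![(P : ℂ), (P : ℂ)] : Matrix (Fin 2) (Fin 2) ℂ) = (P : ℂ) • 1 := by
    ext i j; fin_cases i <;> fin_cases j <;> simp
  have hn : nsq h₁ = x := by
    rw [← ex]
    simp [Matrix.mul_apply, Hm, nsq, Complex.normSq_apply]
  rw [e, Matrix.mul_smul, Matrix.mul_one, Matrix.det_one_add_mul_comm, Matrix.mul_smul, hp, hn]
  nlinarith [mul_nonneg hP hy, mul_le_mul_of_nonneg_left hzxy (sq_nonneg P)]

/-- Asymptotic optimality of compress-and-forward. If `h₁ ≠ 0`,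
`h₂ ≠ 0` and `P_s > 0`, then `R_CF(P) → C*` as `P → ∞` — regardless of the rank of `H`. -/
theorem stmt17 {M N : ℕ} (hM : 0 < M) (hN : 0 < N)
    (G : Matrix (Fin 2) (Fin M) ℂ) (h₁ h₂ : Fin N → ℂ)
    (hh₁ : h₁ ≠ 0) (hh₂ : h₂ ≠ 0) (Ps : ℝ) (hPs : 0 < Ps) :
    Filter.Tendsto (fun P => rCF G h₁ h₂ Ps P) Filter.atTop
      (nhds (Cstar G Ps)) := by
  have hub : ∀ P, ∀ r ∈ {r : ℝ | ∃ (Q : Matrix (Fin M) (Fin M) ℂ) (a b : ℝ),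
    Q.PosSemidef ∧ Q.trace.re ≤ Ps ∧ 0 < a ∧ 0 < b ∧
    ((1 + Matrix.diagonal ![(a : ℂ), (b : ℂ)] + G * Q * Gᴴ).det).re /
        (a * (1 + b + ((G * Q * Gᴴ) 1 1).re)) ≤ 1 + P * nsq h₁ ∧
    ((1 + Matrix.diagonal ![(a : ℂ), (b : ℂ)] + G * Q * Gᴴ).det).re /
        (b * (1 + a + ((G * Q * Gᴴ) 0 0).re)) ≤ 1 + P * nsq h₂ ∧
    ((1 + Matrix.diagonal ![(a : ℂ), (b : ℂ)] + G * Q * Gᴴ).det).re / (a * b) ≤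
      ((1 + Hm h₁ h₂ * Matrix.diagonal ![(P : ℂ), (P : ℂ)] * (Hm h₁ h₂)ᴴ).det).re ∧
    r = Real.log (((1 + Matrix.diagonal ![(a : ℂ), (b : ℂ)] + G * Q * Gᴴ).det).re /
          ((1 + a) * (1 + b)))}, r ≤ Cstar G Ps := by
    rintro P _ ⟨Q, a, b, hQ, ht, ha, hb, -, -, -, rfl⟩
    refine le_trans ?_ (le_csSup (bdd_Cstar G Ps) ⟨Q, hQ, ht, rfl⟩)
    obtain ⟨x, y, z, hx, hy, hz, hzxy, ex, ey, hD, hp⟩ :=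
      psd2 _ (hQ.mul_mul_conjTranspose_same G)
    have h1 := hp 1
    simp only [Complex.ofReal_one, one_smul, one_mul, one_pow] at h1
    rw [h1, hD]
    apply Real.log_le_log
    · apply div_pos _ (by positivity)
      nlinarith [mul_nonneg ha.le hy, mul_nonneg hb.le hx, mul_pos ha hb]
    · rw [div_le_iff₀ (by positivity)]
      have hw : 0 ≤ x * y - z := by linarith
      nlinarith [mul_nonneg ha.le hy, mul_nonneg hb.le hx, mul_pos ha hb, mul_nonneg ha.le hw,
        mul_nonneg hb.le hw, mul_nonneg (mul_pos ha hb).le hw, mul_nonneg (mul_pos ha hb).le hx,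
        mul_nonneg (mul_pos ha hb).le hy, mul_nonneg ha.le hx, mul_nonneg hb.le hy]
  rw [tendsto_order]
  have key : ∀ l < Cstar G Ps, ∀ᶠ P in atTop, l < rCF G h₁ h₂ Ps P ∧
      rCF G h₁ h₂ Ps P ≤ Cstar G Ps := by
    intro l hl
    obtain ⟨_, ⟨Q, hQ, ht, rfl⟩, hlQ⟩ := exists_lt_of_lt_csSup
      (s := {c : ℝ | ∃ Q : Matrix (Fin M) (Fin M) ℂ,
        Q.PosSemidef ∧ Q.trace.re ≤ Ps ∧ c = Real.log ((1 + G * Q * Gᴴ).det).re})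
      (⟨_, 0, Matrix.PosSemidef.zero, by simpa using hPs.le, rfl⟩) hl
    obtain ⟨x, y, z, hx, hy, hz, hzxy, ex, ey, hD, hp⟩ :=
      psd2 _ (hQ.mul_mul_conjTranspose_same G)
    have h1 := hp 1
    simp only [Complex.ofReal_one, one_smul, one_mul, one_pow] at h1
    rw [h1] at hlQ
    have hcont : ContinuousAt (fun t : ℝ =>
        Real.log (((1 + t + x) * (1 + t + y) - z) / ((1 + t) * (1 + t)))) 0 := by
      apply ContinuousAt.log
      · apply ContinuousAt.div (by fun_prop) (by fun_prop)
        norm_num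
      · have : 0 < (1 + x) * (1 + y) - z := by nlinarith
        simpa using this.ne'
    have hev : ∀ᶠ t in nhdsWithin (0 : ℝ) (Set.Ioi 0),
        l < Real.log (((1 + t + x) * (1 + t + y) - z) / ((1 + t) * (1 + t))) := by
      apply nhdsWithin_le_nhds
      apply hcont.eventually_const_lt
      simpa using hlQ
    obtain ⟨t, hlt, ht0⟩ := (hev.and self_mem_nhdsWithin).exists
    have ht0 : 0 < t := ht0
    have t1 : Tendsto (fun P : ℝ => 1 + P * nsq h₁) atTop atTop :=
      tendsto_atTop_add_const_left _ _ (tendsto_id.atTop_mul_const (nsq_pos h₁ hh₁))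
    have t2 : Tendsto (fun P : ℝ => 1 + P * nsq h₂) atTop atTop :=
      tendsto_atTop_add_const_left _ _ (tendsto_id.atTop_mul_const (nsq_pos h₂ hh₂))
    set D := ((1 + t + x) * (1 + t + y) - z) with hDdef
    filter_upwards [t1.eventually_ge_atTop (D / (t * (1 + t + y))),
      t2.eventually_ge_atTop (D / (t * (1 + t + x))), t1.eventually_ge_atTop (D / (t * t)),
      eventually_ge_atTop 0] with P c1 c2 c3 hP
    have hmem : ∃ (Q : Matrix (Fin M) (Fin M) ℂ) (a b : ℝ),
      Q.PosSemidef ∧ Q.trace.re ≤ Ps ∧ 0 < a ∧ 0 < b ∧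
      ((1 + Matrix.diagonal ![(a : ℂ), (b : ℂ)] + G * Q * Gᴴ).det).re /
          (a * (1 + b + ((G * Q * Gᴴ) 1 1).re)) ≤ 1 + P * nsq h₁ ∧
      ((1 + Matrix.diagonal ![(a : ℂ), (b : ℂ)] + G * Q * Gᴴ).det).re /
          (b * (1 + a + ((G * Q * Gᴴ) 0 0).re)) ≤ 1 + P * nsq h₂ ∧
      ((1 + Matrix.diagonal ![(a : ℂ), (b : ℂ)] + G * Q * Gᴴ).det).re / (a * b) ≤
        ((1 + Hm h₁ h₂ * Matrix.diagonal ![(P : ℂ), (P : ℂ)] * (Hm h₁ h₂)ᴴ).det).re ∧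
      Real.log (D / ((1 + t) * (1 + t))) =
        Real.log (((1 + Matrix.diagonal ![(a : ℂ), (b : ℂ)] + G * Q * Gᴴ).det).re /
            ((1 + a) * (1 + b))) := by
      refine ⟨Q, t, t, hQ, ht, ht0, ht0, ?_, ?_, ?_, ?_⟩
      · rw [hD, ey]; exact c1
      · rw [hD, ex]; exact c2
      · rw [hD]; exact c3.trans (det_ge h₁ h₂ P hP)
      · rw [hD]
    exact ⟨hlt.trans_le (le_csSup ⟨_, hub P⟩ hmem), csSup_le ⟨_, hmem⟩ (hub P)⟩
  constructor
  · intro l hl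
    exact (key l hl).mono fun P h => h.1
  · intro u hu
    exact (key _ (sub_one_lt _)).mono fun P h => h.2.trans_lt hu
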